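/- arXiv:1102.4916 — 8 statements merged into one kernel-verified Lean document; each statement's English description precedes it below -/
import Mathlib

section
/- Let σ^{11}, σ^{12}, σ^{22} : ℝ² → ℝ be infinitely differentiable functions satisfying the stress equations ∂₁σ^{11} + ∂₂σ^{12} = 0 and ∂₁σ^{12} + ∂₂σ^{22} = 0 identically on ℝ². Then there exists an infinitely differentiable function φ : ℝ² → ℝ (an Airy function) with σ^{11} = ∂₂∂₂ φ, σ^{12} = −∂₁∂₂ φ, σ^{22} = ∂₁∂₁ φ on ℝ². -/
/-- Partial derivative of a scalar function on ℝⁿ in the i-th coordinate direction. -/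
noncomputable def pd {n : ℕ} (i : Fin n) (f : (Fin n → ℝ) → ℝ) (x : Fin n → ℝ) : ℝ :=
  fderiv ℝ f x (Pi.single i 1)

theorem airy_poincare (P Q : (Fin 2 → ℝ) → ℝ)
    (hP : ContDiff ℝ (⊤ : ℕ∞) P) (hQ : ContDiff ℝ (⊤ : ℕ∞) Q)
    (h : ∀ x, pd 1 P x = pd 0 Q x) :
    ∃ f : (Fin 2 → ℝ) → ℝ, ContDiff ℝ (⊤ : ℕ∞) f ∧ pd 0 f = P ∧ pd 1 f = Q := by
  let p0 : (Fin 2 → ℝ) →L[ℝ] ℝ := ContinuousLinearMap.proj 0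
  let p1 : (Fin 2 → ℝ) →L[ℝ] ℝ := ContinuousLinearMap.proj 1
  let ω : (Fin 2 → ℝ) → ((Fin 2 → ℝ) →L[ℝ] ℝ) := fun x => P x • p0 + Q x • p1
  have hω : ContDiff ℝ (⊤ : ℕ∞) ω := (hP.smul contDiff_const).add (hQ.smul contDiff_const)
  have hPd : Differentiable ℝ P := hP.differentiable (by simp)
  have hQd : Differentiable ℝ Q := hQ.differentiable (by simp)
  have hd : ∀ a, HasFDerivAt ω ((fderiv ℝ P a).smulRight p0 + (fderiv ℝ Q a).smulRight p1) a :=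
    fun a => ((hPd a).hasFDerivAt.smul_const p0).add ((hQd a).hasFDerivAt.smul_const p1)
  have hdec : ∀ (L : (Fin 2 → ℝ) →L[ℝ] ℝ) (v : Fin 2 → ℝ),
      L v = v 0 * L (Pi.single 0 1) + v 1 * L (Pi.single 1 1) := by
    intro L v
    have : v = v 0 • (Pi.single 0 1 : Fin 2 → ℝ) + v 1 • (Pi.single 1 1 : Fin 2 → ℝ) := by
      ext i; fin_cases i <;> simp
    conv_lhs => rw [this]
    simp
  obtain ⟨f, hf⟩ := (convex_univ (𝕜 := ℝ) (E := Fin 2 → ℝ)).exists_forall_hasFDerivAt_of_fderiv_symmetric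
    isOpen_univ (ω := ω) (fun a _ => (hd a).differentiableAt.differentiableWithinAt) (by
      intro a _ x y
      rw [(hd a).fderiv]
      have := h a
      simp only [pd] at this
      simp only [ContinuousLinearMap.add_apply, ContinuousLinearMap.smulRight_apply,
        ContinuousLinearMap.smul_apply, smul_eq_mul, p0, p1, ContinuousLinearMap.proj_apply]
      rw [hdec (fderiv ℝ P a) x, hdec (fderiv ℝ P a) y, hdec (fderiv ℝ Q a) x,
        hdec (fderiv ℝ Q a) y, this]
      ring)
  have hfd : fderiv ℝ f = ω := funext fun a => (hf a (Set.mem_univ a)).fderiv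
  refine ⟨f, ?_, ?_, ?_⟩
  · rw [contDiff_infty_iff_fderiv, hfd]
    exact ⟨fun a => (hf a (Set.mem_univ a)).differentiableAt, hω⟩
  · funext x; simp [pd, hfd, ω, p0, p1]
  · funext x; simp [pd, hfd, ω, p0, p1]

theorem airy_pd_neg (i : Fin 2) (f : (Fin 2 → ℝ) → ℝ) (x : Fin 2 → ℝ) :
    pd i (fun y => - f y) x = - pd i f x := by
  simp [pd, fderiv_fun_neg]

/-- Every smooth solution of the stress equations on ℝ² is parametrized by an Airy
potential: σ¹¹ = ∂₂∂₂φ, σ¹² = −∂₁∂₂φ, σ²² = ∂₁∂₁φ. -/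
theorem stmt_2 (σ11 σ12 σ22 : (Fin 2 → ℝ) → ℝ)
    (h1 : ContDiff ℝ (⊤ : ℕ∞) σ11) (h2 : ContDiff ℝ (⊤ : ℕ∞) σ12) (h3 : ContDiff ℝ (⊤ : ℕ∞) σ22)
    (e1 : ∀ x, pd 0 σ11 x + pd 1 σ12 x = 0)
    (e2 : ∀ x, pd 0 σ12 x + pd 1 σ22 x = 0) :
    ∃ φ : (Fin 2 → ℝ) → ℝ, ContDiff ℝ (⊤ : ℕ∞) φ ∧
      (∀ x, σ11 x = pd 1 (pd 1 φ) x) ∧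
      (∀ x, σ12 x = - pd 0 (pd 1 φ) x) ∧
      (∀ x, σ22 x = pd 0 (pd 0 φ) x) := by
  obtain ⟨B, hB, hB0, hB1⟩ := airy_poincare (fun y => - σ12 y) σ11 h2.neg h1
    (fun x => by rw [airy_pd_neg]; linarith [e1 x])
  obtain ⟨A, hA, hA0, hA1⟩ := airy_poincare σ22 (fun y => - σ12 y) h3 h2.neg
    (fun x => by rw [airy_pd_neg]; linarith [e2 x])
  obtain ⟨φ, hφ, hφ0, hφ1⟩ := airy_poincare A B hA hB (fun x => by rw [hA1, hB0])
  refine ⟨φ, hφ, fun x => ?_, fun x => ?_, fun x => ?_⟩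
  · rw [hφ1, hB1]
  · rw [hφ1, hB0]; simp
  · rw [hφ0, hA0]
end

section
/- Let λ¹, λ² : ℝ³ → ℝ be infinitely differentiable and define μ¹ = ∂₂λ¹ + x³·∂₁λ¹ + ∂₃λ², μ² = −x³·∂₂λ¹ − (x³)²·∂₁λ¹ − x³·∂₃λ² − λ², μ³ = λ¹. Then the compatibility condition ∂₂μ³ + x³·∂₁μ³ − ∂₃μ² − x³·∂₃μ¹ − 2μ¹ = 0 holds identically on ℝ³. -/
/-- The adjoint of the infinitesimal contact operator: μ¹ = ∂₂λ¹ + x³∂₁λ¹ + ∂₃λ²,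
μ² = −x³∂₂λ¹ − (x³)²∂₁λ¹ − x³∂₃λ² − λ², μ³ = λ¹ satisfies the compatibility condition
∂₂μ³ + x³∂₁μ³ − ∂₃μ² − x³∂₃μ¹ − 2μ¹ = 0 on ℝ³. -/
theorem stmt_5 (lam1 lam2 : (Fin 3 → ℝ) → ℝ)
    (h1 : ContDiff ℝ (⊤ : ℕ∞) lam1) (h2 : ContDiff ℝ (⊤ : ℕ∞) lam2)
    (μ1 μ2 μ3 : (Fin 3 → ℝ) → ℝ)
    (hμ1 : ∀ x, μ1 x = pd 1 lam1 x + x 2 * pd 0 lam1 x + pd 2 lam2 x)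
    (hμ2 : ∀ x, μ2 x = - x 2 * pd 1 lam1 x - (x 2) ^ 2 * pd 0 lam1 x
      - x 2 * pd 2 lam2 x - lam2 x)
    (hμ3 : ∀ x, μ3 x = lam1 x) :
    ∀ x, pd 1 μ3 x + x 2 * pd 0 μ3 x - pd 2 μ2 x - x 2 * pd 2 μ1 x - 2 * μ1 x = 0 := by
  intro x
  have d1 : Differentiable ℝ (fderiv ℝ lam1) :=
    (h1.fderiv_right (m := 1) (by norm_cast)).differentiable (by norm_num)
  have d2 : Differentiable ℝ (fderiv ℝ lam2) :=
    (h2.fderiv_right (m := 1) (by norm_cast)).differentiable (by norm_num)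
  have dl2 : Differentiable ℝ lam2 := h2.differentiable (by simp)
  have dμ1 : Differentiable ℝ μ1 := by
    rw [funext hμ1]
    unfold pd
    fun_prop
  have e3 : μ3 = lam1 := funext hμ3
  have e2 : μ2 = fun y => -(y 2 * μ1 y) - lam2 y := by
    funext y
    rw [hμ2, hμ1]
    ring
  have hp : HasFDerivAt (fun y : Fin 3 → ℝ => y 2)
      (ContinuousLinearMap.proj (R := ℝ) (φ := fun _ : Fin 3 => ℝ) 2) x :=
    hasFDerivAt_apply 2 x
  have key : pd 2 μ2 x = -(x 2 * pd 2 μ1 x + μ1 x) - pd 2 lam2 x := by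
    have h := ((hp.mul (dμ1 x).hasFDerivAt).neg).sub (dl2 x).hasFDerivAt
    unfold pd
    rw [e2]
    refine (congrArg (fun L => L (Pi.single (2 : Fin 3) (1 : ℝ))) h.fderiv).trans ?_
    simp
  rw [key, e3]
  have := hμ1 x
  linarith
end

section
/- There is no pair of infinitely differentiable functions f₀, g₀ : ℝ → ℝ with f₀'' = 0 and g₀' = 0 such that every pair (f, g) of infinitely differentiable functions with f'' = 0 and g' = 0 is a finite real linear combination of the pairs of iterated derivatives (f₀^{(k)}, g₀^{(k)}), k ≥ 0. Hence the system y¹_{xx} = 0, y²_x = 0 needs at least two generators. -/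
theorem aux_sum (N : ℕ) (c : Fin N → ℝ) : ∃ a b : ℝ, ∀ h : ℕ → ℝ, (∀ k, h (k + 2) = 0) →
    ∑ k : Fin N, c k * h (k : ℕ) = a * h 0 + b * h 1 := by
  match N, c with
  | 0, c => exact ⟨0, 0, fun h _ => by simp⟩
  | 1, c => exact ⟨c 0, 0, fun h _ => by simp⟩
  | n + 2, c =>
    refine ⟨c 0, c 1, fun h hh => ?_⟩
    rw [Fin.sum_univ_succ, Fin.sum_univ_succ]
    simp [hh]

theorem aux_zero (f : ℝ → ℝ) (m : ℕ) (h : ∀ x, iteratedDeriv m f x = 0) (k : ℕ) :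
    ∀ x, iteratedDeriv (k + m) f x = 0 := by
  induction k with
  | zero => simpa using h
  | succ k ih =>
    intro x
    have e : iteratedDeriv (k + m) f = fun _ => 0 := funext ih
    rw [show k + 1 + m = (k + m) + 1 by omega, iteratedDeriv_succ, e]
    simp

/-- There is no single smooth solution (f₀, g₀) of the system f'' = 0, g' = 0 whose
iterated derivatives generate, by constant real linear combinations (with the same
coefficients in both components), every smooth solution (f, g) of that system.
Hence the system y¹_{xx} = 0, y²_x = 0 needs at least two generators. -/
theorem stmt_8 :
    ¬ ∃ f₀ g₀ : ℝ → ℝ, ContDiff ℝ (⊤ : ℕ∞) f₀ ∧ ContDiff ℝ (⊤ : ℕ∞) g₀ ∧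
      (∀ x, iteratedDeriv 2 f₀ x = 0) ∧ (∀ x, deriv g₀ x = 0) ∧
      ∀ f g : ℝ → ℝ, ContDiff ℝ (⊤ : ℕ∞) f → ContDiff ℝ (⊤ : ℕ∞) g →
        (∀ x, iteratedDeriv 2 f x = 0) → (∀ x, deriv g x = 0) →
        ∃ (N : ℕ) (c : Fin N → ℝ),
          (∀ x, f x = ∑ k : Fin N, c k * iteratedDeriv (k : ℕ) f₀ x) ∧
          (∀ x, g x = ∑ k : Fin N, c k * iteratedDeriv (k : ℕ) g₀ x) := by
  rintro ⟨f₀, g₀, hf, hg, hf2, hg1, H⟩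
  have F2 := aux_zero f₀ 2 hf2
  have G1 := aux_zero g₀ 1 (by simpa [iteratedDeriv_one] using hg1)
  have G2 : ∀ k x, iteratedDeriv (k + 2) g₀ x = 0 := fun k x => G1 (k + 1) x
  have G1' : ∀ x, iteratedDeriv 1 g₀ x = 0 := fun x => G1 0 x
  have K : ∀ f g : ℝ → ℝ, ContDiff ℝ (⊤ : ℕ∞) f → ContDiff ℝ (⊤ : ℕ∞) g →
        (∀ x, iteratedDeriv 2 f x = 0) → (∀ x, deriv g x = 0) →
        ∃ a b : ℝ, (∀ x, f x = a * f₀ x + b * deriv f₀ x) ∧ (∀ x, g x = a * g₀ x) := by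
    intro f g h1 h2 h3 h4
    obtain ⟨N, c, hc, hd⟩ := H f g h1 h2 h3 h4
    obtain ⟨a, b, hab⟩ := aux_sum N c
    refine ⟨a, b, fun x => ?_, fun x => ?_⟩
    · rw [hc x, hab (fun k => iteratedDeriv k f₀ x) (fun k => F2 k x)]
      simp [iteratedDeriv_one]
    · rw [hd x, hab (fun k => iteratedDeriv k g₀ x) (fun k => G2 k x)]
      simp only [G1', iteratedDeriv_zero, mul_zero, add_zero]
  obtain ⟨a, b, h1, h2⟩ := K (fun _ => 0) (fun _ => 1) contDiff_const contDiff_const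
    (by intro x; simp [iteratedDeriv_succ]) (by simp)
  have ha : a ≠ 0 := by
    rintro rfl
    simpa using h2 0
  have hdd : ∀ x, deriv (deriv f₀) x = 0 := by
    intro x
    have := hf2 x
    rwa [iteratedDeriv_succ, iteratedDeriv_one] at this
  have hdiff : Differentiable ℝ (deriv f₀) := by
    have := hf.differentiable_iteratedDeriv 1 (by exact_mod_cast ENat.coe_lt_top 1)
    rwa [iteratedDeriv_one] at this
  have hconst : ∀ x, deriv f₀ x = deriv f₀ 0 := fun x =>
    is_const_of_deriv_eq_zero hdiff hdd x 0
  have hf0 : f₀ = fun _ => -(b * deriv f₀ 0) / a := by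
    funext x
    have := h1 x
    rw [hconst x] at this
    field_simp
    linarith
  have hd0 : ∀ x, deriv f₀ x = 0 := by
    intro x
    rw [hf0]
    simp
  have hz : ∀ x, f₀ x = 0 := by
    intro x
    have := h1 x
    simpa [hd0, ha] using this
  obtain ⟨a', b', h3, -⟩ := K (fun x => x) (fun _ => 0) contDiff_id contDiff_const
    (by intro x; simp [iteratedDeriv_succ]) (by simp)
  simpa [hz, hd0] using h3 1
end

section
/- Let n ≥ 3 and let X : Fin n → Fin n → Fin n → Fin n → ℝ (written X^k_{ijl}) be totally symmetric in the last three indices (i, j, l) and satisfy, for all k, i, j, l, the conformal symbol relation n·X^k_{ijl} = δ^k_i·S_{jl} + δ^k_j·S_{il} − δ_{ij}·S_{kl}, where S_{jl} = Σ_r X^r_{rjl} and δ denotes the Kronecker delta. Then X = 0. (That is, the third symbol ĝ₃ of the conformal Killing system of the Euclidean metric vanishes for n ≥ 3.) -/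
/-- For n ≥ 3, a four-index real array X^k_{ijl}, totally symmetric in its last three
indices and satisfying the conformal symbol relation
n·X^k_{ijl} = δ^k_i·S_{jl} + δ^k_j·S_{il} − δ_{ij}·S_{kl} with S_{jl} = Σ_r X^r_{rjl},
vanishes: the third symbol ĝ₃ of the conformal Killing system is zero for n ≥ 3. -/
theorem stmt_10 (n : ℕ) (hn : 3 ≤ n) (X : Fin n → Fin n → Fin n → Fin n → ℝ)
    (hsym1 : ∀ k i j l, X k i j l = X k j i l)
    (hsym2 : ∀ k i j l, X k i j l = X k i l j)
    (hrel : ∀ k i j l, (n : ℝ) * X k i j l =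
        (if k = i then (1 : ℝ) else 0) * (∑ r, X r r j l)
        + (if k = j then (1 : ℝ) else 0) * (∑ r, X r r i l)
        - (if i = j then (1 : ℝ) else 0) * (∑ r, X r r k l)) :
    X = 0 := by
  obtain ⟨S, hS⟩ : ∃ S : Fin n → Fin n → ℝ, ∀ j l, S j l = ∑ r, X r r j l := ⟨_, fun _ _ => rfl⟩
  simp only [← hS] at hrel
  have hSs : ∀ j l, S j l = S l j := by
    intro j l
    rw [hS, hS]
    exact Finset.sum_congr rfl fun r _ => hsym2 r r j l
  have third : ∀ i l : Fin n, ∃ a, a ≠ i ∧ a ≠ l := by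
    intro i l
    have hc : ({i, l} : Finset (Fin n)).card < (Finset.univ : Finset (Fin n)).card := by
      have := Finset.card_le_two (a := i) (b := l)
      simp only [Finset.card_univ, Fintype.card_fin]
      omega
    obtain ⟨a, -, ha⟩ := Finset.exists_mem_notMem_of_card_lt_card hc
    refine ⟨a, ?_, ?_⟩ <;> rintro rfl <;> simp at ha
  have key : ∀ a i l, a ≠ i → a ≠ l → S i l = - ((if i = l then (1 : ℝ) else 0) * S a a) := by
    intro a i l h1 h2
    have e1 := hrel a i a l
    have e2 := hrel a i l a
    rw [hsym2 a i a l, e2, hSs l a] at e1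
    simp only [h1, h1.symm, h2, if_true, if_false] at e1
    linarith
  have hd : ∀ a i, a ≠ i → S i i = - S a a := by
    intro a i h
    simpa using key a i i h h
  have hz : ∀ i l, S i l = 0 := by
    intro i l
    obtain ⟨a, h1, h2⟩ := third i l
    by_cases h : i = l
    · subst h
      obtain ⟨b, h3, h4⟩ := third i a
      linarith [hd a i h1, hd b i h3, hd b a h4]
    · rw [key a i l h1 h2]
      simp [h]
  have hn0 : (n : ℝ) ≠ 0 := by
    have : n ≠ 0 := by omega
    exact_mod_cast this
  funext k i j l
  have e := hrel k i j l
  simp only [hz, mul_zero, add_zero, sub_zero] at e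
  exact (mul_eq_zero.mp e).resolve_left hn0
end

section
/- Let n ≥ 1. The real vector space of arrays R : Fin n → Fin n → Fin n → Fin n → ℝ satisfying R_{klij} = −R_{klji}, R_{klij} = −R_{lkij}, and R_{klij} + R_{kijl} + R_{kjli} = 0 for all indices has dimension n²(n² − 1)/12. -/
/-- The space of algebraic Riemann curvature tensors on ℝⁿ: four-index arrays
antisymmetric in the last pair, antisymmetric in the first pair, and satisfying the
first Bianchi (cyclic) identity. -/
def riemannTensors (n : ℕ) : Submodule ℝ (Fin n → Fin n → Fin n → Fin n → ℝ) where
  carrier := { R | (∀ k l i j, R k l i j = - R k l j i) ∧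
      (∀ k l i j, R k l i j = - R l k i j) ∧
      (∀ k l i j, R k l i j + R k i j l + R k j l i = 0) }
  add_mem' := by
    rintro R S ⟨hR1, hR2, hR3⟩ ⟨hS1, hS2, hS3⟩
    refine ⟨fun k l i j => ?_, fun k l i j => ?_, fun k l i j => ?_⟩ <;>
      simp only [Pi.add_apply]
    · linear_combination hR1 k l i j + hS1 k l i j
    · linear_combination hR2 k l i j + hS2 k l i j
    · linear_combination hR3 k l i j + hS3 k l i j
  zero_mem' := by
    refine ⟨fun k l i j => ?_, fun k l i j => ?_, fun k l i j => ?_⟩ <;> simp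
  smul_mem' := by
    rintro c R ⟨hR1, hR2, hR3⟩
    refine ⟨fun k l i j => ?_, fun k l i j => ?_, fun k l i j => ?_⟩ <;>
      simp only [Pi.smul_apply, smul_eq_mul]
    · linear_combination c * hR1 k l i j
    · linear_combination c * hR2 k l i j
    · linear_combination c * hR3 k l i j

/-- antisymmetrized, pair-symmetrized component -/
def rmA {n : ℕ} (R : Fin n → Fin n → Fin n → Fin n → ℝ) (k l i j : Fin n) : ℝ :=
  R k l i j - R l k i j - R k l j i + R l k j i
    + R i j k l - R i j l k - R j i k l + R j i l k

/-- The projection onto curvature tensors. -/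
noncomputable def rmP (n : ℕ) : (Fin n → Fin n → Fin n → Fin n → ℝ) →ₗ[ℝ] (Fin n → Fin n → Fin n → Fin n → ℝ) where
  toFun R := fun k l i j =>
    (1/12 : ℝ) * rmA R k l i j - (1/24) * rmA R k i j l - (1/24) * rmA R k j l i
  map_add' R S := by
    funext k l i j
    simp only [rmA, Pi.add_apply]
    ring
  map_smul' c R := by
    funext k l i j
    simp only [rmA, Pi.smul_apply, smul_eq_mul, RingHom.id_apply]
    ring

theorem rmP_apply {n : ℕ} (R : Fin n → Fin n → Fin n → Fin n → ℝ) (k l i j : Fin n) :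
    rmP n R k l i j =
    (1/12 : ℝ) * rmA R k l i j - (1/24) * rmA R k i j l - (1/24) * rmA R k j l i := rfl

theorem rmP_isProj (n : ℕ) : LinearMap.IsProj (riemannTensors n) (rmP n) where
  map_mem R := by
    refine ⟨fun k l i j => ?_, fun k l i j => ?_, fun k l i j => ?_⟩ <;>
      simp only [rmP_apply, rmA] <;> ring
  map_id R hR := by
    obtain ⟨h1, h2, h3⟩ := hR
    have hA : ∀ k l i j, R i j k l = R k l i j := by
      intro k l i j
      linarith [h3 k l i j, h3 l k i j, h3 i j k l, h3 j i k l,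
        h1 k l i j, h1 k i j l, h1 k j l i, h1 l k i j, h1 l i j k, h1 l j k i,
        h1 i j k l, h1 i k l j, h1 i l j k, h1 j i k l, h1 j k l i, h1 j l i k,
        h2 k l i j, h2 k i j l, h2 k j l i, h2 l i j k, h2 l j k i, h2 i j k l,
        h2 k l j i, h2 k i l j, h2 k j i l, h2 l i k j, h2 l j i k, h2 i j l k]
    have hB : ∀ k l i j, rmA R k l i j = 8 * R k l i j := by
      intro k l i j
      unfold rmA
      linarith [hA k l i j, hA l k i j, hA k l j i, hA l k j i, h1 k l i j, h2 k l i j, h2 k l j i]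
    funext k l i j
    rw [rmP_apply, hB, hB, hB]
    linarith [h3 k l i j]

/-- currying equivalence -/
def rmE (n : ℕ) : (Fin n → Fin n → Fin n → Fin n → ℝ) ≃ₗ[ℝ] (Fin n × Fin n × Fin n × Fin n → ℝ) where
  toFun R p := R p.1 p.2.1 p.2.2.1 p.2.2.2
  invFun f k l i j := f (k, l, i, j)
  map_add' _ _ := rfl
  map_smul' _ _ := rfl
  left_inv _ := rfl
  right_inv _ := rfl

theorem rmP_trace (n : ℕ) : LinearMap.trace ℝ _ (rmP n) = (n:ℝ)^2 * ((n:ℝ)^2 - 1) / 12 := by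
  have key : LinearMap.trace ℝ _ (rmP n) = ∑ k : Fin n, ∑ l : Fin n, ∑ i : Fin n, ∑ j : Fin n,
      rmP n (fun a b c d => (if a = k then 1 else 0) * (if b = l then 1 else 0) *
        (if c = i then 1 else 0) * (if d = j then 1 else 0)) k l i j := by
    rw [LinearMap.trace_eq_matrix_trace ℝ (Module.Basis.ofEquivFun (rmE n))]
    simp only [Matrix.trace, Matrix.diag, LinearMap.toMatrix_apply, Fintype.sum_prod_type,
      Module.Basis.ofEquivFun_repr_apply, Module.Basis.coe_ofEquivFun]
    refine Finset.sum_congr rfl fun k _ => Finset.sum_congr rfl fun l _ =>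
      Finset.sum_congr rfl fun i _ => Finset.sum_congr rfl fun j _ => ?_
    have : (rmE n).symm (Pi.single (k, l, i, j) 1) =
      (fun a b c d => (if a = k then 1 else 0) * (if b = l then 1 else 0) *
        (if c = i then 1 else 0) * (if d = j then 1 else 0)) := by
      funext a b c d
      change (Pi.single (k, l, i, j) (1:ℝ) : _ → ℝ) (a, b, c, d) = _
      simp only [Pi.single_apply, Prod.mk.injEq]
      split_ifs <;> simp_all
    rw [this]
    rfl
  rw [key]
  simp only [rmP_apply, rmA, mul_add, mul_sub, Finset.sum_add_distrib, Finset.sum_sub_distrib,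
    ← Finset.mul_sum]
  simp [Finset.sum_ite_eq, Finset.sum_ite_eq']
  ring

/-- The space of algebraic Riemann curvature tensors on ℝⁿ has dimension n²(n²−1)/12. -/
theorem stmt_14 (n : ℕ) (hn : 1 ≤ n) :
    Module.finrank ℝ (riemannTensors n) = n ^ 2 * (n ^ 2 - 1) / 12 := by
  have h := (rmP_isProj n).trace
  rw [rmP_trace] at h
  have h12 : 12 * Module.finrank ℝ (riemannTensors n) = n ^ 2 * (n ^ 2 - 1) := by
    have h1 : 1 ≤ n ^ 2 := Nat.one_le_pow _ _ hn
    have : ((12 * Module.finrank ℝ (riemannTensors n) : ℕ) : ℝ) = (n ^ 2 * (n ^ 2 - 1) : ℕ) := by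
      push_cast [Nat.cast_sub h1]
      rw [← h]
      ring
    exact_mod_cast this
  omega
end

section
/- Let ω : ℝ → ℝ be any function and let f, g : ℝ → ℝ be infinitely differentiable functions each satisfying the general affine Lie equation in the form h''(x) + ω(h(x))·(h'(x))² = ω(x)·h'(x) for all x ∈ ℝ (for h = f and h = g). Then the composition g ∘ f also satisfies this equation: (g∘f)''(x) + ω(g(f(x)))·((g∘f)'(x))² = ω(x)·(g∘f)'(x) for all x ∈ ℝ. Hence the solutions of the general affine Lie equation form a pseudogroup under composition. -/
/-- The solutions of the general affine Lie equation
h'' + ω(h)·(h')² = ω(x)·h' are stable under composition: if smooth f and g both satisfy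
it, then so does g ∘ f. -/
theorem stmt_17 (ω : ℝ → ℝ) (f g : ℝ → ℝ)
    (hf : ContDiff ℝ (⊤ : ℕ∞) f) (hg : ContDiff ℝ (⊤ : ℕ∞) g)
    (hfe : ∀ x, deriv (deriv f) x + ω (f x) * (deriv f x) ^ 2 = ω x * deriv f x)
    (hge : ∀ x, deriv (deriv g) x + ω (g x) * (deriv g x) ^ 2 = ω x * deriv g x) :
    ∀ x, deriv (deriv (g ∘ f)) x + ω (g (f x)) * (deriv (g ∘ f) x) ^ 2
      = ω x * deriv (g ∘ f) x := by
  have df : Differentiable ℝ f := hf.differentiable (by simp)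
  have dg : Differentiable ℝ g := hg.differentiable (by simp)
  have df' : Differentiable ℝ (deriv f) :=
    ((contDiff_infty_iff_deriv.1 hf).2).differentiable (by simp)
  have dg' : Differentiable ℝ (deriv g) :=
    ((contDiff_infty_iff_deriv.1 hg).2).differentiable (by simp)
  have h1 : deriv (g ∘ f) = fun x => deriv g (f x) * deriv f x := by
    funext x
    exact deriv_comp x (dg _) (df x)
  intro x
  have h2 : deriv (deriv (g ∘ f)) x
      = deriv (deriv g) (f x) * deriv f x * deriv f x + deriv g (f x) * deriv (deriv f) x := by
    rw [h1]
    exact (((dg' (f x)).hasDerivAt.comp x (df x).hasDerivAt).mul (df' x).hasDerivAt).deriv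
  rw [h2, h1]
  linear_combination (deriv f x) ^ 2 * hge (f x) + deriv g (f x) * hfe x
end

section
/- Let ω : ℝ → ℝ be any function and let f, g : ℝ → ℝ be infinitely differentiable functions each satisfying the general projective Lie equation in the denominator-free form h'''(x)·h'(x) − (3/2)·(h''(x))² + ω(h(x))·(h'(x))⁴ = ω(x)·(h'(x))² for all x ∈ ℝ (for h = f and h = g). Then the composition g ∘ f also satisfies this equation for all x ∈ ℝ. Hence the solutions of the general projective Lie equation form a pseudogroup under composition. -/
/-- The solutions of the general projective Lie equation (in denominator-free form)
h'''·h' − (3/2)·(h'')² + ω(h)·(h')⁴ = ω(x)·(h')² are stable under composition: if smooth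
f and g both satisfy it, then so does g ∘ f. -/
theorem stmt_18 (ω : ℝ → ℝ) (f g : ℝ → ℝ)
    (hf : ContDiff ℝ (⊤ : ℕ∞) f) (hg : ContDiff ℝ (⊤ : ℕ∞) g)
    (hfe : ∀ x, iteratedDeriv 3 f x * deriv f x - (3 / 2) * (deriv (deriv f) x) ^ 2
      + ω (f x) * (deriv f x) ^ 4 = ω x * (deriv f x) ^ 2)
    (hge : ∀ x, iteratedDeriv 3 g x * deriv g x - (3 / 2) * (deriv (deriv g) x) ^ 2
      + ω (g x) * (deriv g x) ^ 4 = ω x * (deriv g x) ^ 2) :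
    ∀ x, iteratedDeriv 3 (g ∘ f) x * deriv (g ∘ f) x
      - (3 / 2) * (deriv (deriv (g ∘ f)) x) ^ 2
      + ω (g (f x)) * (deriv (g ∘ f) x) ^ 4 = ω x * (deriv (g ∘ f) x) ^ 2 := by
  have key : ∀ u : ℝ → ℝ, ContDiff ℝ (⊤ : ℕ∞) u →
      (∀ x, HasDerivAt u (deriv u x) x) ∧ ContDiff ℝ (⊤ : ℕ∞) (deriv u) := by
    intro u hu
    have h := contDiff_infty_iff_deriv.1 hu
    exact ⟨fun x => (h.1 x).hasDerivAt, h.2⟩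
  have h3 : ∀ u : ℝ → ℝ, iteratedDeriv 3 u = deriv (deriv (deriv u)) := by
    intro u
    simp [iteratedDeriv_succ, iteratedDeriv_zero]
  obtain ⟨f1, hf1⟩ := key f hf
  obtain ⟨f2, hf2⟩ := key _ hf1
  obtain ⟨f3, -⟩ := key _ hf2
  obtain ⟨g1, hg1⟩ := key g hg
  obtain ⟨g2, hg2⟩ := key _ hg1
  obtain ⟨g3, -⟩ := key _ hg2
  have e1 : deriv (g ∘ f) = fun x => deriv g (f x) * deriv f x := by
    funext x
    exact ((g1 (f x)).comp x (f1 x)).deriv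
  have e2 : deriv (deriv (g ∘ f)) = fun x =>
      deriv (deriv g) (f x) * deriv f x * deriv f x + deriv g (f x) * deriv (deriv f) x := by
    rw [e1]
    funext x
    exact (((g2 (f x)).comp x (f1 x)).mul (f2 x)).deriv
  have e3 : deriv (deriv (deriv (g ∘ f))) = fun x =>
      ((deriv (deriv (deriv g)) (f x) * deriv f x) * deriv f x
        + deriv (deriv g) (f x) * deriv (deriv f) x) * deriv f x
        + deriv (deriv g) (f x) * deriv f x * deriv (deriv f) x
      + (deriv (deriv g) (f x) * deriv f x * deriv (deriv f) x
        + deriv g (f x) * deriv (deriv (deriv f)) x) := by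
    rw [e2]
    funext x
    exact (((((g3 (f x)).comp x (f1 x)).mul (f2 x)).mul (f2 x)).add
      (((g2 (f x)).comp x (f1 x)).mul (f3 x))).deriv
  intro x
  have A := hfe x
  have B := hge (f x)
  rw [h3] at A B ⊢
  rw [e3, e2, e1]
  linear_combination (deriv f x) ^ 4 * B + (deriv g (f x)) ^ 2 * A
end

section
/- Let n ≥ 1, let f : ℝⁿ → ℝⁿ (components f^k) be infinitely differentiable, let f₁ : ℝⁿ → (n×n real matrices) (entries f^k_i) be infinitely differentiable with f₁(x) invertible for every x, with pointwise inverse g = f₁⁻¹ (entries g^k_l), and let f₂ : ℝⁿ → (Fin n → Fin n → Fin n → ℝ) (entries f^l_{ij}) be infinitely differentiable with f^l_{ij} = f^l_{ji}. Define A^k_i = Σ_l g^k_l ∂_i f^l, χ^k_{,i} = A^k_i − δ^k_i, and χ^k_{j,i} = Σ_l g^k_l (∂_i f^l_j − Σ_r A^r_i f^l_{rj}). Then the first nonlinear Spencer structure equation holds identically on ℝⁿ for all k, i, j: ∂_i χ^k_{,j} − ∂_j χ^k_{,i} − χ^k_{i,j} + χ^k_{j,i} − Σ_r (χ^r_{,i}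 χ^k_{r,j} − χ^r_{,j} χ^k_{r,i}) = 0. -/
lemma aux_two : (2 : WithTop ℕ∞) ≤ ((⊤ : ℕ∞) : WithTop ℕ∞) :=
  WithTop.coe_le_coe.2 (le_top : (2 : ℕ∞) ≤ ⊤)

lemma aux_two' : (1 + 1 : WithTop ℕ∞) ≤ ((⊤ : ℕ∞) : WithTop ℕ∞) :=
  WithTop.coe_le_coe.2 (le_top : (1 + 1 : ℕ∞) ≤ ⊤)

lemma aux_det {n : ℕ} (M : (Fin n → ℝ) → Matrix (Fin n) (Fin n) ℝ)
    (h : ∀ i j, Differentiable ℝ (fun x => M x i j)) :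
    Differentiable ℝ (fun x => (M x).det) := by
  simp only [Matrix.det_apply']
  fun_prop

lemma aux_g {n : ℕ} (f1 g : (Fin n → ℝ) → Fin n → Fin n → ℝ)
    (hf1 : ∀ k i, Differentiable ℝ (fun x => f1 x k i))
    (hinv1 : ∀ x k l, ∑ m, f1 x k m * g x m l = if k = l then (1 : ℝ) else 0) (k l : Fin n) :
    Differentiable ℝ (fun x => g x k l) := by
  have h1 : ∀ x, (Matrix.of (f1 x)) * (Matrix.of (g x)) = 1 := by
    intro x
    ext a b
    simp [Matrix.mul_apply, Matrix.one_apply, hinv1]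
  have hdet : ∀ x, (Matrix.of (f1 x)).det ≠ 0 := by
    intro x h0
    have := congrArg Matrix.det (h1 x)
    rw [Matrix.det_mul, h0] at this
    simp at this
  have hg : ∀ x, g x k l = (Matrix.of (f1 x)).det⁻¹ * (Matrix.of (f1 x)).adjugate k l := by
    intro x
    have := Matrix.inv_eq_right_inv (h1 x)
    rw [Matrix.inv_def] at this
    have h2 := congrFun (congrFun this k) l
    simp at h2
    exact h2.symm
  have hd : Differentiable ℝ (fun x => (Matrix.of (f1 x)).det) := aux_det _ (by simpa using hf1)
  have ha : Differentiable ℝ (fun x => (Matrix.of (f1 x)).adjugate k l) := by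
    simp only [Matrix.adjugate_apply]
    apply aux_det
    intro a b
    by_cases h : a = l
    · subst h
      simp
    · simp [Matrix.updateRow_ne h, hf1]
  simp only [hg]
  exact (hd.inv hdet).mul ha

lemma aux_pd {n : ℕ} (f : (Fin n → ℝ) → ℝ) (hf : ContDiff ℝ (⊤ : ℕ∞) f) (i : Fin n) :
    Differentiable ℝ (fun x => pd i f x) := by
  have h : ContDiff ℝ 1 (fderiv ℝ f) := hf.fderiv_right aux_two'
  have h2 := h.differentiable (by norm_num)
  unfold pd
  fun_prop

lemma aux_comm {n : ℕ} (f : (Fin n → ℝ) → ℝ) (hf : ContDiff ℝ (⊤ : ℕ∞) f) (i j : Fin n)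
    (x : Fin n → ℝ) : pd i (fun y => pd j f y) x = pd j (fun y => pd i f y) x := by
  have h : ContDiff ℝ 1 (fderiv ℝ f) := hf.fderiv_right aux_two'
  have h2 := (h.differentiable (by norm_num)) x
  have hs : IsSymmSndFDerivAt ℝ f x := by
    apply hf.contDiffAt.isSymmSndFDerivAt
    simpa using aux_two
  unfold pd
  rw [fderiv_clm_apply h2 (by fun_prop), fderiv_clm_apply h2 (by fun_prop)]
  simp
  exact hs _ _

lemma aux_mul {n : ℕ} (a b : Fin n → (Fin n → ℝ) → ℝ) (ha : ∀ r, Differentiable ℝ (a r))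
    (hb : ∀ r, Differentiable ℝ (b r)) (i : Fin n) (x : Fin n → ℝ) :
    pd i (fun y => ∑ r, a r y * b r y) x = ∑ r, (pd i (a r) x * b r x + a r x * pd i (b r) x) := by
  unfold pd
  rw [fderiv_fun_sum (fun r _ => (ha r x).fun_mul (hb r x))]
  simp only [ContinuousLinearMap.sum_apply]
  refine Finset.sum_congr rfl fun r _ => ?_
  rw [fderiv_fun_mul (ha r x) (hb r x)]
  simp
  ring

lemma aux_cancel {n : ℕ} (P Q : Fin n → Fin n → ℝ)
    (h : ∀ k l, ∑ m, P k m * Q m l = if k = l then (1 : ℝ) else 0) (v : Fin n → ℝ) (k : Fin n) :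
    ∑ l, P k l * ∑ r, Q l r * v r = v k := by
  simp only [Finset.mul_sum]
  rw [Finset.sum_comm]
  simp only [← mul_assoc, ← Finset.sum_mul, h]
  simp

/-- For a (not necessarily holonomic) smooth section (f, f₁, f₂) of the second-order jet
groupoid on ℝⁿ — f₁ pointwise invertible with inverse g, f₂ symmetric in its lower
indices — the components A^k_i = Σ_l g^k_l ∂_i f^l, χ^k_{,i} = A^k_i − δ^k_i and
χ^k_{j,i} = Σ_l g^k_l (∂_i f^l_j − Σ_r A^r_i f^l_{rj}) of χ₁ = D̄f₂ satisfy the first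
nonlinear Spencer structure equation
∂_iχ^k_{,j} − ∂_jχ^k_{,i} − χ^k_{i,j} + χ^k_{j,i} − Σ_r (χ^r_{,i}χ^k_{r,j} − χ^r_{,j}χ^k_{r,i}) = 0. -/
theorem stmt_19 (n : ℕ) (hn : 1 ≤ n)
    (f : (Fin n → ℝ) → Fin n → ℝ)
    (f1 : (Fin n → ℝ) → Fin n → Fin n → ℝ)
    (g : (Fin n → ℝ) → Fin n → Fin n → ℝ)
    (f2 : (Fin n → ℝ) → Fin n → Fin n → Fin n → ℝ)
    (hf : ∀ k, ContDiff ℝ (⊤ : ℕ∞) (fun x => f x k))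
    (hf1 : ∀ k i, ContDiff ℝ (⊤ : ℕ∞) (fun x => f1 x k i))
    (hf2 : ∀ l i j, ContDiff ℝ (⊤ : ℕ∞) (fun x => f2 x l i j))
    (hinv1 : ∀ x k l, ∑ m, f1 x k m * g x m l = if k = l then (1 : ℝ) else 0)
    (hinv2 : ∀ x k l, ∑ m, g x k m * f1 x m l = if k = l then (1 : ℝ) else 0)
    (hsym : ∀ x l i j, f2 x l i j = f2 x l j i)
    (A : Fin n → Fin n → (Fin n → ℝ) → ℝ)
    (hA : ∀ k i x, A k i x = ∑ l, g x k l * pd i (fun y => f y l) x)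
    (χ0 : Fin n → Fin n → (Fin n → ℝ) → ℝ)
    (hχ0 : ∀ k i x, χ0 k i x = A k i x - if k = i then (1 : ℝ) else 0)
    (χ1 : Fin n → Fin n → Fin n → (Fin n → ℝ) → ℝ)
    (hχ1 : ∀ k j i x, χ1 k j i x =
      ∑ l, g x k l * (pd i (fun y => f1 y l j) x - ∑ r, A r i x * f2 x l r j)) :
    ∀ k i j x, pd i (χ0 k j) x - pd j (χ0 k i) x - χ1 k i j x + χ1 k j i x
      - ∑ r, (χ0 r i x * χ1 k r j x - χ0 r j x * χ1 k r i x) = 0 := by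
  intro k i j x
  have df1 : ∀ k i, Differentiable ℝ (fun x => f1 x k i) :=
    fun k i => (hf1 k i).differentiable (by simp)
  have dg := aux_g f1 g df1 hinv1
  have dA : ∀ k i, Differentiable ℝ (A k i) := by
    intro k i
    have : A k i = fun x => ∑ l, g x k l * pd i (fun y => f y l) x := funext (hA k i)
    rw [this]
    have := fun l => aux_pd _ (hf l) i
    fun_prop
  have hfA : ∀ l i, (fun y => ∑ r, f1 y l r * A r i y) = fun y => pd i (fun z => f z l) y := by
    intro l i
    funext y
    simp only [hA]
    exact aux_cancel (f1 y) (g y) (hinv1 y) (fun l => pd i (fun z => f z l) y) l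
  have hχ : ∀ k i x, pd i (χ0 k j) x = pd i (A k j) x ∧ pd j (χ0 k i) x = pd j (A k i) x := by
    intro k i x
    have e : ∀ j, χ0 k j = fun x => A k j x - if k = j then (1 : ℝ) else 0 :=
      fun j => funext (hχ0 k j)
    unfold pd
    rw [e, e, fderiv_sub_const, fderiv_sub_const]
    exact ⟨rfl, rfl⟩
  have hl : ∀ l, ∑ r, f1 x l r * (pd i (A r j) x - pd j (A r i) x) =
      ∑ r, (pd j (fun y => f1 y l r) x * A r i x - pd i (fun y => f1 y l r) x * A r j x) := by
    intro l
    have h1 := aux_mul (fun r y => f1 y l r) (fun r => A r j) (df1 l) (fun r => dA r j) i x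
    have h2 := aux_mul (fun r y => f1 y l r) (fun r => A r i) (df1 l) (fun r => dA r i) j x
    rw [hfA l] at h1 h2
    rw [aux_comm _ (hf l)] at h1
    rw [h1] at h2
    simp only [Finset.sum_add_distrib] at h2
    simp only [mul_sub, Finset.sum_sub_distrib]
    linarith
  have hc := aux_cancel (g x) (f1 x) (hinv2 x) (fun r => pd i (A r j) x - pd j (A r i) x) k
  simp only [hl] at hc
  have hsymm : ∑ r, A r i x * ∑ l, g x k l * ∑ s, A s j x * f2 x l s r =
      ∑ r, A r j x * ∑ l, g x k l * ∑ s, A s i x * f2 x l s r := by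
    simp only [Finset.mul_sum]
    rw [Finset.sum_comm]
    conv_rhs => rw [Finset.sum_comm]
    refine Finset.sum_congr rfl fun l _ => ?_
    rw [Finset.sum_comm]
    refine Finset.sum_congr rfl fun r _ => Finset.sum_congr rfl fun s _ => ?_
    rw [hsym x l r s]
    ring
  have hB : ∑ l, g x k l * ∑ r, (pd j (fun y => f1 y l r) x * A r i x
        - pd i (fun y => f1 y l r) x * A r j x) =
      ∑ r, A r i x * ∑ l, g x k l * pd j (fun y => f1 y l r) x
       - ∑ r, A r j x * ∑ l, g x k l * pd i (fun y => f1 y l r) x := by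
    simp only [Finset.mul_sum]
    rw [Finset.sum_comm, ← Finset.sum_sub_distrib]
    refine Finset.sum_congr rfl fun r _ => ?_
    rw [← Finset.sum_sub_distrib]
    refine Finset.sum_congr rfl fun l _ => ?_
    ring
  have hT : ∀ i j, ∑ r, χ0 r i x * χ1 k r j x =
      ∑ r, A r i x * ∑ l, g x k l * pd j (fun y => f1 y l r) x
      - ∑ r, A r i x * ∑ l, g x k l * ∑ s, A s j x * f2 x l s r - χ1 k i j x := by
    intro i j
    simp only [hχ0, sub_mul, Finset.sum_sub_distrib]
    congr 1
    · rw [← Finset.sum_sub_distrib]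
      refine Finset.sum_congr rfl fun r _ => ?_
      rw [hχ1, ← mul_sub, ← Finset.sum_sub_distrib]
      simp only [mul_sub]
    · simp
  rw [(hχ k i x).1, (hχ k i x).2, Finset.sum_sub_distrib, hT i j, hT j i]
  linarith
end
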